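/- arXiv:1509.07174 — 3 statements merged into one kernel-verified Lean document; each statement's English description precedes it below -/
import Mathlib

section
/- For every n ≥ 1, the poset NC_n of noncrossing partitions of {1,…,n} ordered by refinement is self-dual: there exists a bijection φ : NC_n → NC_n such that for all p, q ∈ NC_n one has p ≤ q if and only if φ(q) ≤ φ(p). -/
open Finset

/-- A finite partition of `{0, …, n-1}` is noncrossing if there are no indices
`a < b < c < d` with `a, c` in one block and `b, d` in a different block. -/
def Noncrossing {n : ℕ} (P : Finpartition (univ : Finset (Fin n))) : Prop :=
  ¬ ∃ (a b c d : Fin n) (B₁ B₂ : Finset (Fin n)),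
      a < b ∧ b < c ∧ c < d ∧ B₁ ∈ P.parts ∧ B₂ ∈ P.parts ∧ B₁ ≠ B₂ ∧
      a ∈ B₁ ∧ c ∈ B₁ ∧ b ∈ B₂ ∧ d ∈ B₂

/-- The set `NC_n` of noncrossing partitions of `{1, …, n}`. -/
abbrev NC (n : ℕ) := {P : Finpartition (univ : Finset (Fin n)) // Noncrossing P}

/-- Refinement order: every block of `p` is contained in some block of `q`. -/
def NCle {n : ℕ} (p q : NC n) : Prop :=
  ∀ B ∈ p.1.parts, ∃ C ∈ q.1.parts, B ⊆ C

/-- The relation underlying the Kreweras complement: `i` and `j` are related if the cuts after `i`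
and after `j` separate the same pairs of `r`-related points. -/
def krewerasSetoid {n : ℕ} (r : Setoid (Fin n)) : Setoid (Fin n) where
  r i j := ∀ x y, r x y → ((x ≤ i ↔ y ≤ i) ↔ (x ≤ j ↔ y ≤ j))
  iseqv :=
    ⟨fun _ _ _ _ ↦ Iff.rfl, fun h x y hxy ↦ (h x y hxy).symm,
      fun h h' x y hxy ↦ (h x y hxy).trans (h' x y hxy)⟩

theorem krewerasSetoid_noncrossing {n : ℕ} {r : Setoid (Fin n)} {a b c d : Fin n}
    (hab : a < b) (hbc : b < c) (hcd : c < d) (hac : krewerasSetoid r a c)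
    (hbd : krewerasSetoid r b d) : krewerasSetoid r a b := by
  intro x y hxy
  have h₁ := hac x y hxy
  have h₂ := hbd x y hxy
  simp only [Fin.lt_def, Fin.le_def] at *
  omega

/-- In a noncrossing relation, two unrelated points `x < y` are separated by one of two cuts that
are related in the Kreweras complement, but not by the other. -/
theorem exists_krewerasSetoid_of_not_rel {n : ℕ} {r : Setoid (Fin n)}
    (hr : ∀ a b c d, a < b → b < c → c < d → r a c → r b d → r a b)
    {x y : Fin n} (hxy : x < y) (h : ¬ r x y) :
    ∃ i j, krewerasSetoid r i j ∧ x ≤ i ∧ i < y ∧ ¬ (x ≤ j ∧ j < y) := by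
  classical
  have hsymm : ∀ a b, r a b → r b a := fun _ _ ↦ r.symm'
  have htrans : ∀ a b c, r a b → r b c → r a c := fun _ _ _ ↦ r.trans'
  obtain ⟨u, hu, hu_max⟩ := (univ.filter fun z ↦ r x z ∧ z < y).exists_max_image id
    ⟨x, by simpa using hxy⟩
  simp only [mem_filter, mem_univ, true_and, id] at hu hu_max
  have hxu : x ≤ u := hu_max x ⟨r.refl' x, hxy⟩
  by_cases hB : ∃ v, r x v ∧ y < v
  · obtain ⟨v, hv, hv_min⟩ := (univ.filter fun z ↦ r x z ∧ y < z).exists_min_image id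
      (by simpa [Finset.Nonempty] using hB)
    simp only [mem_filter, mem_univ, true_and, id] at hv hv_min
    refine ⟨u, ⟨v - 1, by omega⟩, ?_, hxu, hu.2, by simp only [Fin.lt_def, Fin.le_def] at *; omega⟩
    have key : ∀ z w, r z w → u < z → z < v → u < w ∧ w < v := by
      intro z w hzw huz hzv
      have hz : ¬ r x z := by grind
      by_contra hw
      grind
    intro z w hzw
    have h₁ := key z w hzw
    have h₂ := key w z (hsymm _ _ hzw)
    simp only [Fin.lt_def, Fin.le_def] at *
    omega
  · obtain ⟨m, hm, hm_min⟩ := (univ.filter fun z ↦ r x z).exists_min_image id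
      ⟨x, by simp⟩
    simp only [mem_filter, mem_univ, true_and, id] at hm hm_min
    have hmx : m ≤ x := hm_min x (r.refl' x)
    have key : ∀ z w, r z w → m ≤ z → z ≤ u → m ≤ w ∧ w ≤ u := by
      intro z w hzw hmz hzu
      by_cases hz : r x z
      · grind
      · have hmu := htrans m x u (hsymm x m hm) hu.1
        have h₁ := hr w m z u
        have h₂ := hr m z u w
        clear hr
        grind
    by_cases hm0 : (m : ℕ) = 0
    · refine ⟨u, ⟨n - 1, by omega⟩, ?_, hxu, hu.2, by simp only [Fin.lt_def, Fin.le_def] at *; omega⟩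
      intro z w hzw
      have h₁ := key z w hzw
      have h₂ := key w z (hsymm _ _ hzw)
      simp only [Fin.lt_def, Fin.le_def] at *
      omega
    · refine ⟨u, ⟨m - 1, by omega⟩, ?_, hxu, hu.2, by simp only [Fin.lt_def, Fin.le_def] at *; omega⟩
      intro z w hzw
      have h₁ := key z w hzw
      have h₂ := key w z (hsymm _ _ hzw)
      simp only [Fin.lt_def, Fin.le_def] at *
      omega

/-- On noncrossing relations, taking Kreweras complements reflects the order. -/
theorem le_of_krewerasSetoid_le {n : ℕ} {r s : Setoid (Fin n)}
    (hs : ∀ a b c d, a < b → b < c → c < d → s a c → s b d → s a b)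
    (h : krewerasSetoid s ≤ krewerasSetoid r) : r ≤ s := by
  have key : ∀ x y, x < y → r x y → s x y := by
    intro x y hxy hr
    by_contra hn
    obtain ⟨i, j, hij, h₁, h₂, h₃⟩ := exists_krewerasSetoid_of_not_rel hs hxy hn
    have h₄ := h hij x y hr
    simp only [Fin.lt_def, Fin.le_def] at *
    omega
  intro x y hxy
  rcases lt_trichotomy x y with hlt | rfl | hlt
  · exact key x y hlt hxy
  · exact s.refl' x
  · exact s.symm' (key y x hlt (r.symm' hxy))

theorem krewerasSetoid_antitone {n : ℕ} : Antitone (krewerasSetoid (n := n)) :=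
  fun _ _ h _ _ hij x y hxy ↦ hij x y (h hxy)

namespace Finpartition

/-- The relation of lying in the same block of a finite partition. -/
def blockSetoid {α : Type*} [Fintype α] [DecidableEq α] (P : Finpartition (univ : Finset α)) :
    Setoid α :=
  Setoid.ker P.part

theorem blockSetoid_iff_exists {α : Type*} [Fintype α] [DecidableEq α]
    {P : Finpartition (univ : Finset α)} {x y : α} :
    P.blockSetoid x y ↔ ∃ B ∈ P.parts, x ∈ B ∧ y ∈ B := by
  rw [← mem_part_iff_exists, mem_part_iff_part_eq_part _ (mem_univ _) (mem_univ _)]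
  rfl

theorem blockSetoid_le_iff {α : Type*} [Fintype α] [DecidableEq α]
    {P Q : Finpartition (univ : Finset α)} : P.blockSetoid ≤ Q.blockSetoid ↔ P ≤ Q := by
  constructor
  · intro h B hB
    obtain ⟨x, hx⟩ := P.nonempty_of_mem_parts hB
    refine ⟨Q.part x, Q.part_mem.2 (mem_univ x), fun y hy ↦ ?_⟩
    rw [mem_part_iff_part_eq_part _ (mem_univ _) (mem_univ _)]
    exact h (blockSetoid_iff_exists.2 ⟨B, hB, hy, hx⟩)
  · intro h x y hxy
    obtain ⟨B, hB, hx, hy⟩ := blockSetoid_iff_exists.1 hxy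
    obtain ⟨C, hC, hBC⟩ := h hB
    exact blockSetoid_iff_exists.2 ⟨C, hC, hBC hx, hBC hy⟩

theorem blockSetoid_ofSetoid {α : Type*} [Fintype α] [DecidableEq α] (s : Setoid α)
    [DecidableRel s.r] : (ofSetoid s).blockSetoid = s := by
  ext x y
  rw [← mem_part_ofSetoid_iff_rel (s := s), mem_part_iff_exists, blockSetoid_iff_exists]
  simp only [and_comm]

end Finpartition

theorem noncrossing_iff {n : ℕ} {P : Finpartition (univ : Finset (Fin n))} :
    Noncrossing P ↔ ∀ a b c d, a < b → b < c → c < d →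
      P.blockSetoid a c → P.blockSetoid b d → P.blockSetoid a b := by
  simp only [Finpartition.blockSetoid_iff_exists]
  constructor
  · rintro h a b c d hab hbc hcd ⟨B, hB, ha, hc⟩ ⟨C, hC, hb, hd⟩
    by_contra hn
    refine h ⟨a, b, c, d, B, C, hab, hbc, hcd, hB, hC, ?_, ha, hc, hb, hd⟩
    rintro rfl
    exact hn ⟨B, hB, ha, hb⟩
  · rintro h ⟨a, b, c, d, B, C, hab, hbc, hcd, hB, hC, hne, ha, hc, hb, hd⟩
    obtain ⟨D, hD, ha', hb'⟩ := h a b c d hab hbc hcd ⟨B, hB, ha, hc⟩ ⟨C, hC, hb, hd⟩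
    exact hne ((P.eq_of_mem_parts hB hD ha ha').trans (P.eq_of_mem_parts hD hC hb' hb))

open scoped Classical in
/-- The Kreweras complement of a noncrossing partition. -/
noncomputable def krewerasComplement {n : ℕ} (p : NC n) : NC n :=
  ⟨Finpartition.ofSetoid (krewerasSetoid p.1.blockSetoid), by
    rw [noncrossing_iff]
    convert fun a b c d ↦ krewerasSetoid_noncrossing (r := p.1.blockSetoid) (a := a) (b := b)
      (c := c) (d := d) <;> exact Finpartition.blockSetoid_ofSetoid _⟩

theorem blockSetoid_krewerasComplement {n : ℕ} (p : NC n) :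
    (krewerasComplement p).1.blockSetoid = krewerasSetoid p.1.blockSetoid := by
  classical
  exact Finpartition.blockSetoid_ofSetoid _

theorem krewerasComplement_le_iff {n : ℕ} {p q : NC n} :
    NCle (krewerasComplement q) (krewerasComplement p) ↔ NCle p q := by
  change (krewerasComplement q).1 ≤ (krewerasComplement p).1 ↔ p.1 ≤ q.1
  rw [← Finpartition.blockSetoid_le_iff, ← Finpartition.blockSetoid_le_iff,
    blockSetoid_krewerasComplement, blockSetoid_krewerasComplement]
  exact ⟨le_of_krewerasSetoid_le (noncrossing_iff.1 q.2), fun h ↦ krewerasSetoid_antitone h⟩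

theorem krewerasComplement_injective {n : ℕ} :
    Function.Injective (krewerasComplement (n := n)) := by
  intro p q h
  have hle : ∀ {p q : NC n}, krewerasComplement p = krewerasComplement q → p.1 ≤ q.1 :=
    fun {p q} h ↦ krewerasComplement_le_iff.1 (h ▸ le_refl (krewerasComplement p).1)
  exact Subtype.ext (le_antisymm (hle h) (hle h.symm))

/-- For every `n ≥ 1`, the poset `NC_n` of noncrossing partitions of
`{1,…,n}` ordered by refinement is self-dual: there exists a bijection
`φ : NC_n → NC_n` such that `p ≤ q ↔ φ q ≤ φ p` for all `p, q`. -/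
theorem noncrossing_partition_lattice_self_dual (n : ℕ) (hn : 1 ≤ n) :
    ∃ φ : NC n → NC n, Function.Bijective φ ∧
      ∀ p q : NC n, NCle p q ↔ NCle (φ q) (φ p) := by
  exact ⟨krewerasComplement, Finite.injective_iff_bijective.1 krewerasComplement_injective,
    fun _ _ ↦ krewerasComplement_le_iff.symm⟩
end

section
/- Let n ≥ 1 and let φ : NC_n → NC_n be a bijection such that for all p, q ∈ NC_n one has p ≤ q if and only if φ(q) ≤ φ(p). Then for every q ∈ NC_n, at least one of the partitions q and φ(q) contains a singleton block. -/
open Finset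

namespace Finpartition

variable {α : Type*} [DecidableEq α] {s : Finset α}

theorem eq_of_le_of_card_parts_le {P Q : Finpartition s} (h : P ≤ Q)
    (hcard : #P.parts ≤ #Q.parts) : P = Q := by
  have hex : ∀ C ∈ Q.parts, ∃ B ∈ P.parts, B ⊆ C := fun C hC ↦ exists_le_of_le h hC
  choose! f hfP hfC using hex
  have hinj : Set.InjOn f Q.parts := by
    intro C hC D hD hCD
    obtain ⟨a, ha⟩ := P.nonempty_of_mem_parts (hfP C hC)
    exact Q.eq_of_mem_parts hC hD (hfC C hC ha) (hfC D hD (hCD ▸ ha))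
  have himage : Q.parts.image f = P.parts := by
    refine eq_of_subset_of_card_le (image_subset_iff.2 hfP) ?_
    rwa [card_image_of_injOn hinj]
  have hsub : Q.parts ⊆ P.parts := by
    intro C hC
    suffices C = f C from this ▸ hfP C hC
    refine Subset.antisymm (fun a ha ↦ ?_) (hfC C hC)
    obtain ⟨B, hB, haB⟩ := P.exists_mem (Q.le hC ha)
    rw [← himage, mem_image] at hB
    obtain ⟨D, hD, rfl⟩ := hB
    rwa [Q.eq_of_mem_parts hC hD ha (hfC D hD haB)]
  exact Finpartition.ext (eq_of_subset_of_card_le hsub hcard).symm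

theorem card_parts_lt_of_lt {P Q : Finpartition s} (h : P < Q) : #Q.parts < #P.parts := by
  by_contra! hcard
  exact h.ne (eq_of_le_of_card_parts_le h.le hcard)

/-- The partition obtained from `P` by making `{x}` a block of its own. -/
def isolate (P : Finpartition s) {x : α} (hx : x ∈ s) : Finpartition s :=
  (P.avoid {x}).extend (singleton_ne_empty x) sdiff_disjoint
    (sdiff_union_of_subset (singleton_subset_iff.2 hx))

theorem mem_isolate (P : Finpartition s) {x : α} (hx : x ∈ s) {B : Finset α} :
    B ∈ (P.isolate hx).parts ↔
      B = {x} ∨ ∃ C ∈ P.parts, ¬ C ⊆ {x} ∧ C \ {x} = B := by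
  simp only [isolate, extend_parts, mem_insert, mem_avoid]

theorem isolate_le (P : Finpartition s) {x : α} (hx : x ∈ s) : P.isolate hx ≤ P := by
  intro B hB
  obtain rfl | ⟨C, hC, -, rfl⟩ := (P.mem_isolate hx).1 hB
  · obtain ⟨C, hC, hxC⟩ := P.exists_mem hx
    exact ⟨C, hC, singleton_subset_iff.2 hxC⟩
  · exact ⟨C, hC, sdiff_subset⟩

theorem card_parts_isolate_le (P : Finpartition s) {x : α} (hx : x ∈ s) :
    #(P.isolate hx).parts ≤ #P.parts + 1 := by
  rw [isolate, card_extend]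
  exact Nat.succ_le_succ ((card_erase_le).trans card_image_le)

theorem two_mul_card_parts_le (P : Finpartition s) (h : ∀ x, {x} ∉ P.parts) :
    2 * #P.parts ≤ #s := by
  rw [← P.sum_card_parts, mul_comm]
  refine P.parts.card_nsmul_le_sum (fun B ↦ #B) 2 fun B hB ↦ ?_
  have hpos := (P.nonempty_of_mem_parts hB).card_pos
  have hne : #B ≠ 1 := fun h1 ↦ by
    obtain ⟨x, rfl⟩ := card_eq_one.1 h1
    exact h x hB
  lia

theorem card_le_card_parts (P : Finpartition s) (h : ∀ x ∈ s, {x} ∈ P.parts) :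
    #s ≤ #P.parts :=
  card_le_card_of_injOn (fun x ↦ {x}) h (singleton_injective.injOn)

end Finpartition

theorem Noncrossing.isolate {n : ℕ} {P : Finpartition (univ : Finset (Fin n))}
    (hP : Noncrossing P) (x : Fin n) : Noncrossing (P.isolate (mem_univ x)) := by
  rintro ⟨a, b, c, d, B₁, B₂, hab, hbc, hcd, hB₁, hB₂, hne, ha, hc, hb, hd⟩
  rw [Finpartition.mem_isolate] at hB₁ hB₂
  obtain rfl | ⟨C₁, hC₁, -, rfl⟩ := hB₁
  · simp only [mem_singleton] at ha hc
    lia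
  obtain rfl | ⟨C₂, hC₂, -, rfl⟩ := hB₂
  · simp only [mem_singleton] at hb hd
    lia
  exact hP ⟨a, b, c, d, C₁, C₂, hab, hbc, hcd, hC₁, hC₂, fun h ↦ hne (h ▸ rfl),
    sdiff_subset ha, sdiff_subset hc, sdiff_subset hb, sdiff_subset hd⟩

theorem NCle_iff {n : ℕ} {p q : NC n} : NCle p q ↔ p.1 ≤ q.1 :=
  ⟨fun h _ hB ↦ h _ hB, fun h _ hB ↦ h hB⟩

theorem card_parts_add_card_parts_dual_ge {n : ℕ} (hn : 1 ≤ n) (φ : NC n → NC n)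
    (hrev : ∀ p q : NC n, NCle p q ↔ NCle (φ q) (φ p)) (q : NC n) :
    n + 1 ≤ #q.1.parts + #(φ q).1.parts := by
  induction hk : n - #q.1.parts using Nat.strong_induction_on generalizing q with
  | _ k ih =>
    by_cases h : ∀ x, {x} ∈ q.1.parts
    · have hcard := q.1.card_le_card_parts fun x _ ↦ h x
      rw [card_univ, Fintype.card_fin] at hcard
      obtain ⟨B, hB, -⟩ := (φ q).1.exists_mem (mem_univ (⟨0, hn⟩ : Fin n))
      have hpos := card_pos.2 ⟨B, hB⟩
      lia
    · push Not at h
      obtain ⟨x, hx⟩ := h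
      let p : NC n := ⟨q.1.isolate (mem_univ x), q.2.isolate x⟩
      have hpq : p.1 < q.1 := (q.1.isolate_le (mem_univ x)).lt_of_ne fun h ↦
        hx (h ▸ (q.1.mem_isolate (mem_univ x)).2 (Or.inl rfl))
      have hφ : (φ q).1 < (φ p).1 := by
        refine lt_of_le_not_ge (NCle_iff.1 ((hrev p q).1 (NCle_iff.2 hpq.le))) fun h ↦ ?_
        exact hpq.not_ge (NCle_iff.1 ((hrev q p).2 (NCle_iff.2 h)))
      have hcard : #p.1.parts ≤ #q.1.parts + 1 := q.1.card_parts_isolate_le (mem_univ x)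
      have hlt := Finpartition.card_parts_lt_of_lt hpq
      have hltφ := Finpartition.card_parts_lt_of_lt hφ
      have hle := p.1.card_parts_le_card
      rw [card_univ, Fintype.card_fin] at hle
      have := ih (n - #p.1.parts) (by lia) p rfl
      lia

/-- If `φ : NC_n → NC_n` is an order-reversing bijection
(`p ≤ q ↔ φ q ≤ φ p`), then for every `q ∈ NC_n`, at least one of the partitions
`q` and `φ q` contains a singleton block. -/
theorem singleton_block_of_self_or_dual (n : ℕ) (hn : 1 ≤ n)
    (φ : NC n → NC n) (hbij : Function.Bijective φ)
    (hrev : ∀ p q : NC n, NCle p q ↔ NCle (φ q) (φ p)) (q : NC n) :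
    (∃ x : Fin n, ({x} : Finset (Fin n)) ∈ q.1.parts) ∨
      (∃ x : Fin n, ({x} : Finset (Fin n)) ∈ (φ q).1.parts) := by
  by_contra! h
  have hq := q.1.two_mul_card_parts_le h.1
  have hφq := (φ q).1.two_mul_card_parts_le h.2
  have hge := card_parts_add_card_parts_dual_ge hn φ hrev q
  rw [card_univ, Fintype.card_fin] at hq hφq
  lia
end

section
/- Let R be a commutative ring and V a free R-module. Write T(V) for the tensor algebra of V over R, containing V as its degree-one component and T² := V ⊗_R V as its degree-two component. Let J be a two-sided ideal of T(V) with J ∩ V = 0, set J₂ := J ∩ (V ⊕ T²), and let I ⊆ T² be the image of J₂ under the projection V ⊕ T² → T². Then: (1) there is a unique R-linear map φ : I → V such that φ(r) + r ∈ J for every r ∈ I; and (2) for every element x of the intersection (V ⊗_R I) ∩ (I ⊗_R V), viewed inside V ⊗_R V ⊗_R V, the element (φ ⊗ id_V)(x) − (id_V ⊗ φ)(x) of V ⊗_R V lies in I, and φ((φ ⊗ id_V)(x) − (id_V ⊗ φ)(x)) = 0. -/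
open scoped TensorProduct

/-- The canonical `R`-linear inclusion of `V ⊗ V` as the degree-two component of the
tensor algebra `T(V)`, sending `v ⊗ w` to `ι v * ι w`. -/
noncomputable def T2 (R V : Type*) [CommRing R] [AddCommGroup V] [Module R V] :
    (V ⊗[R] V) →ₗ[R] TensorAlgebra R V :=
  (LinearMap.mul' R (TensorAlgebra R V)).comp
    (TensorProduct.map (TensorAlgebra.ι R) (TensorAlgebra.ι R))

/-- Given a submodule `J` of the tensor algebra, the submodule `I ⊆ V ⊗ V` which is
the image under the projection `V ⊕ T² → T²` of `J₂ = J ∩ (V ⊕ T²)`: it consists of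
those `x ∈ V ⊗ V` such that `ι v + x ∈ J` for some `v ∈ V`. -/
noncomputable def quadPart (R V : Type*) [CommRing R] [AddCommGroup V] [Module R V]
    (J : Submodule R (TensorAlgebra R V)) : Submodule R (V ⊗[R] V) where
  carrier := {x | ∃ v : V, TensorAlgebra.ι R v + T2 R V x ∈ J}
  zero_mem' := ⟨0, by simp⟩
  add_mem' := by
    rintro x y ⟨v, hv⟩ ⟨w, hw⟩
    refine ⟨v + w, ?_⟩
    have h := J.add_mem hv hw
    rw [map_add, map_add]
    convert h using 1
    abel
  smul_mem' := by
    rintro c x ⟨v, hv⟩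
    refine ⟨c • v, ?_⟩
    have h := J.smul_mem c hv
    rw [map_smul, map_smul]
    convert h using 1
    rw [smul_add]

/-- The canonical inclusion of `V ⊗ (V ⊗ V)` as the degree-three component of the tensor
algebra. -/
noncomputable def T3 (R V : Type*) [CommRing R] [AddCommGroup V] [Module R V] :
    (V ⊗[R] (V ⊗[R] V)) →ₗ[R] TensorAlgebra R V :=
  (LinearMap.mul' R (TensorAlgebra R V)).comp
    (TensorProduct.map (TensorAlgebra.ι R) (T2 R V))

section

variable {R V : Type*} [CommRing R] [AddCommGroup V] [Module R V]

@[simp]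
theorem T2_tmul (v w : V) :
    T2 R V (v ⊗ₜ w) = TensorAlgebra.ι R v * TensorAlgebra.ι R w := by
  simp [T2]

@[simp]
theorem T3_tmul (v : V) (x : V ⊗[R] V) :
    T3 R V (v ⊗ₜ x) = TensorAlgebra.ι R v * T2 R V x := by
  simp [T3]

theorem T3_assoc_tmul (x : V ⊗[R] V) (v : V) :
    T3 R V (TensorProduct.assoc R V V V (x ⊗ₜ v)) = T2 R V x * TensorAlgebra.ι R v := by
  induction x with
  | zero => simp
  | tmul a b => simp [mul_assoc]
  | add a b ha hb => simp only [TensorProduct.add_tmul, map_add, ha, hb, add_mul]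

theorem T2_rTensor_add_T3_mem {J : Submodule R (TensorAlgebra R V)}
    (hJr : ∀ a : TensorAlgebra R V, ∀ x ∈ J, x * a ∈ J)
    {I : Submodule R (V ⊗[R] V)} {φ : I →ₗ[R] V}
    (hφ : ∀ r : I, TensorAlgebra.ι R (φ r) + T2 R V (r : V ⊗[R] V) ∈ J) (y : I ⊗[R] V) :
    T2 R V (LinearMap.rTensor V φ y) +
      T3 R V (TensorProduct.assoc R V V V (LinearMap.rTensor V I.subtype y)) ∈ J := by
  induction y with
  | zero => simp
  | tmul r v =>
    rw [LinearMap.rTensor_tmul, LinearMap.rTensor_tmul, T3_assoc_tmul, T2_tmul, ← add_mul]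
    exact hJr _ _ (hφ r)
  | add a b ha hb =>
    simp only [map_add]
    rw [add_add_add_comm]
    exact J.add_mem ha hb

theorem T2_lTensor_add_T3_mem {J : Submodule R (TensorAlgebra R V)}
    (hJl : ∀ a : TensorAlgebra R V, ∀ x ∈ J, a * x ∈ J)
    {I : Submodule R (V ⊗[R] V)} {φ : I →ₗ[R] V}
    (hφ : ∀ r : I, TensorAlgebra.ι R (φ r) + T2 R V (r : V ⊗[R] V) ∈ J) (z : V ⊗[R] I) :
    T2 R V (LinearMap.lTensor V φ z) + T3 R V (LinearMap.lTensor V I.subtype z) ∈ J := by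
  induction z with
  | zero => simp
  | tmul v r =>
    rw [LinearMap.lTensor_tmul, LinearMap.lTensor_tmul, T3_tmul, T2_tmul, ← mul_add]
    exact hJl _ _ (hφ r)
  | add a b ha hb =>
    simp only [map_add]
    rw [add_add_add_comm]
    exact J.add_mem ha hb

end

/-- Let `R` be a commutative ring, `V` a free `R`-module, and `J` a
two-sided ideal of the tensor algebra `T(V)` with `J ∩ V = 0`.  Let
`I ⊆ T² = V ⊗ V` be the image of `J₂ := J ∩ (V ⊕ T²)` under the projection onto
`T²`.  Then:
(1) there is a unique `R`-linear map `φ : I → V` with `φ(r) + r ∈ J` for all `r ∈ I`;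
(2) for every element of `(V ⊗ I) ∩ (I ⊗ V)` inside `V ⊗ V ⊗ V` — presented as a
pair `y : I ⊗ V`, `z : V ⊗ I` having the same image in `V ⊗ (V ⊗ V)` — the element
`(φ ⊗ id)(y) − (id ⊗ φ)(z)` of `V ⊗ V` lies in `I`, and `φ` of it is `0`. -/
theorem linear_quadratic_phi (R V : Type*) [CommRing R] [AddCommGroup V] [Module R V]
    [Module.Free R V]
    (J : Submodule R (TensorAlgebra R V))
    (hJl : ∀ a : TensorAlgebra R V, ∀ x ∈ J, a * x ∈ J)
    (hJr : ∀ a : TensorAlgebra R V, ∀ x ∈ J, x * a ∈ J)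
    (hJV : ∀ v : V, TensorAlgebra.ι R v ∈ J → v = 0) :
    (∃! φ : ↥(quadPart R V J) →ₗ[R] V,
        ∀ r : ↥(quadPart R V J),
          TensorAlgebra.ι R (φ r) + T2 R V (r : V ⊗[R] V) ∈ J) ∧
      (∀ φ : ↥(quadPart R V J) →ₗ[R] V,
        (∀ r : ↥(quadPart R V J),
          TensorAlgebra.ι R (φ r) + T2 R V (r : V ⊗[R] V) ∈ J) →
        ∀ (y : ↥(quadPart R V J) ⊗[R] V) (z : V ⊗[R] ↥(quadPart R V J)),
          (TensorProduct.assoc R V V V)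
              (LinearMap.rTensor V (quadPart R V J).subtype y)
            = LinearMap.lTensor V (quadPart R V J).subtype z →
          ∃ h : LinearMap.rTensor V φ y - LinearMap.lTensor V φ z ∈ quadPart R V J,
            φ ⟨LinearMap.rTensor V φ y - LinearMap.lTensor V φ z, h⟩ = 0) := by
  have huniq : ∀ (v w : V) (x : V ⊗[R] V), TensorAlgebra.ι R v + T2 R V x ∈ J →
      TensorAlgebra.ι R w + T2 R V x ∈ J → v = w := by
    intro v w x hv hw
    refine sub_eq_zero.mp (hJV _ ?_)
    have h := J.sub_mem hv hw
    rwa [add_sub_add_right_eq_sub, ← map_sub] at h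
  refine ⟨?_, ?_⟩
  · choose f hf using fun r : ↥(quadPart R V J) => r.2
    refine ⟨{ toFun := f, map_add' := ?_, map_smul' := ?_ }, hf, ?_⟩
    · intro r s
      refine huniq _ _ _ (hf (r + s)) ?_
      have h := J.add_mem (hf r) (hf s)
      rwa [add_add_add_comm, ← map_add, ← map_add] at h
    · intro c r
      refine huniq _ _ _ (hf (c • r)) ?_
      have h := J.smul_mem c (hf r)
      rwa [smul_add, ← map_smul, ← map_smul] at h
    · intro ψ hψ
      ext r
      exact huniq _ _ _ (hψ r) (hf r)
  · intro φ hφ y z hyz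
    have hw : T2 R V (LinearMap.rTensor V φ y - LinearMap.lTensor V φ z) ∈ J := by
      have h := J.sub_mem (T2_rTensor_add_T3_mem hJr hφ y) (T2_lTensor_add_T3_mem hJl hφ z)
      rwa [hyz, add_sub_add_right_eq_sub, ← map_sub] at h
    have hw₀ : TensorAlgebra.ι R (0 : V) +
        T2 R V (LinearMap.rTensor V φ y - LinearMap.lTensor V φ z) ∈ J := by
      rwa [map_zero, zero_add]
    exact ⟨⟨0, hw₀⟩, huniq _ _ _ (hφ ⟨_, ⟨0, hw₀⟩⟩) hw₀⟩
end
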